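/- The routing number of the d-dimensional pyramid Δ_{m,d} with N vertices satisfies rt(Δ_{m,d}) = O(d · N^{1/d}). -/

import Mathlib

open Finset

variable {V : Type*}

/-- A stage of a sorting network on a graph `G`: a finite set of vertex-disjoint
edges of `G`, each either directed (compare-exchange) or undirected (swap). -/
structure Stage {V : Type*} (G : SimpleGraph V) where
  pairs : Finset (V × V)
  adj : ∀ p ∈ pairs, G.Adj p.1 p.2
  directed : V × V → Bool
  disj : ∀ p ∈ pairs, ∀ q ∈ pairs, p ≠ q →
    p.1 ≠ q.1 ∧ p.1 ≠ q.2 ∧ p.2 ≠ q.1 ∧ p.2 ≠ q.2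

open scoped Classical in
/-- Apply a stage to a configuration of keys `f : V → ℕ`.  For a directed pair
`(u,v)` the smaller key goes to `u` and the larger to `v`; an undirected pair
unconditionally swaps its keys. -/
noncomputable def Stage.apply {G : SimpleGraph V} (s : Stage G) (f : V → ℕ) (v : V) : ℕ :=
  if h1 : ∃ p, p ∈ s.pairs ∧ p.1 = v then
    (if s.directed h1.choose then min (f h1.choose.1) (f h1.choose.2) else f h1.choose.2)
  else if h2 : ∃ p, p ∈ s.pairs ∧ p.2 = v then
    (if s.directed h2.choose then max (f h2.choose.1) (f h2.choose.2) else f h2.choose.1)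
  else f v

noncomputable def runNetwork {G : SimpleGraph V} (L : List (Stage G)) (f : V → ℕ) : V → ℕ :=
  L.foldl (fun g s => s.apply g) f

/-- `L` is a sorting network on `(G, π)`: for every injective assignment of keys,
after running all stages, the key at a vertex of smaller `π`-rank is smaller. -/
def IsSortingNetwork {n : ℕ} (G : SimpleGraph V) (π : V ≃ Fin n) (L : List (Stage G)) : Prop :=
  ∀ f : V → ℕ, Function.Injective f →
    ∀ u w : V, π u < π w → runNetwork L f u < runNetwork L f w

/-- Minimal depth of a sorting network on `(G, π)`. -/
noncomputable def stP {n : ℕ} (G : SimpleGraph V) (π : V ≃ Fin n) : ℕ :=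
  sInf {t | ∃ L : List (Stage G), L.length = t ∧ IsSortingNetwork G π L}

/-- The sorting number of `G` : the minimum over sorted orders `π` of the
minimal depth of a sorting network on `(G, π)`. -/
noncomputable def st [Fintype V] (G : SimpleGraph V) : ℕ :=
  sInf {t | ∃ π : V ≃ Fin (Fintype.card V), ∃ L : List (Stage G),
    L.length = t ∧ IsSortingNetwork G π L}

/-- A matching step: an involution of the vertices moving pebbles only along edges. -/
def IsMatchingStep (G : SimpleGraph V) (σ : Equiv.Perm V) : Prop :=
  (∀ v, σ (σ v) = v) ∧ ∀ v, σ v ≠ v → G.Adj v (σ v)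

/-- Position of a pebble starting at `v` after applying the matching steps in `L`. -/
def finalPos (L : List (Equiv.Perm V)) (v : V) : V :=
  L.foldl (fun p σ => σ p) v

/-- `t` matching steps of `G` suffice to route every pebble from `v` to `σ v`. -/
def RoutesIn (G : SimpleGraph V) (σ : Equiv.Perm V) (t : ℕ) : Prop :=
  ∃ L : List (Equiv.Perm V), L.length = t ∧ (∀ τ ∈ L, IsMatchingStep G τ) ∧
    ∀ v, finalPos L v = σ v

/-- Routing time of the permutation `σ` on `G`. -/
noncomputable def rtP (G : SimpleGraph V) (σ : Equiv.Perm V) : ℕ :=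
  sInf {t | RoutesIn G σ t}

/-- The routing number of `G`. -/
noncomputable def rt [Fintype V] [DecidableEq V] (G : SimpleGraph V) : ℕ :=
  Finset.univ.sup fun σ : Equiv.Perm V => rtP G σ

/-- Vertices of the `d`-dimensional pyramid with `m` levels: a level
`l ∈ {0,…,m-1}` together with `d` coordinates, each `< 2^l`. -/
abbrev PyrV (m d : ℕ) : Type :=
  {x : Fin m × (Fin d → Fin (2 ^ m)) // ∀ i, (x.2 i : ℕ) < 2 ^ (x.1 : ℕ)}

/-- One-directional step relation generating the pyramid's edges: either a mesh
edge within a level (one coordinate increases by `1`, the others agree), or the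
parent relation between consecutive levels (the parent's coordinates are the
halves of the child's coordinates). -/
def pyrStep (m d : ℕ) (x y : PyrV m d) : Prop :=
  (x.1.1 = y.1.1 ∧ ∃ i : Fin d, (x.1.2 i : ℕ) + 1 = (y.1.2 i : ℕ) ∧
    ∀ j, j ≠ i → x.1.2 j = y.1.2 j) ∨
  ((x.1.1 : ℕ) + 1 = (y.1.1 : ℕ) ∧ ∀ i, (x.1.2 i : ℕ) = (y.1.2 i : ℕ) / 2)

/-- The `d`-dimensional pyramid graph with `m` levels. -/
def pyramid (m d : ℕ) : SimpleGraph (PyrV m d) :=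
  SimpleGraph.fromRel (pyrStep m d)


namespace PyrRoute

section basic
variable {G : SimpleGraph V}

lemma routes_zero : RoutesIn G 1 0 := ⟨[], rfl, by simp, fun v => rfl⟩

lemma routes_comp {σ τ : Equiv.Perm V} {a b : ℕ} (h1 : RoutesIn G σ a) (h2 : RoutesIn G τ b) :
    RoutesIn G (τ * σ) (a + b) := by
  obtain ⟨L, hL, hm, hf⟩ := h1
  obtain ⟨M, hM, hm', hf'⟩ := h2
  refine ⟨L ++ M, by simp [hL, hM], ?_, ?_⟩
  · intro x hx
    rcases List.mem_append.1 hx with h | h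
    · exact hm x h
    · exact hm' x h
  · intro v
    have e : finalPos (L ++ M) v = finalPos M (finalPos L v) := by simp [finalPos]
    rw [e, hf, hf']; rfl

lemma routes_single {τ : Equiv.Perm V} (h : IsMatchingStep G τ) : RoutesIn G τ 1 :=
  ⟨[τ], rfl, by simpa using h, fun v => rfl⟩

lemma matching_one : IsMatchingStep G (1 : Equiv.Perm V) := ⟨fun v => rfl, fun v h => absurd rfl h⟩

lemma routes_one (t : ℕ) : RoutesIn G 1 t := by
  induction t with
  | zero => exact routes_zero
  | succ t ih => simpa using routes_comp ih (routes_single matching_one)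

lemma routes_mono {σ : Equiv.Perm V} {a b : ℕ} (h : RoutesIn G σ a) (hab : a ≤ b) :
    RoutesIn G σ b := by
  obtain ⟨c, rfl⟩ := Nat.exists_eq_add_of_le hab
  simpa using routes_comp h (routes_one c)

lemma routes_succ_inv {σ : Equiv.Perm V} {t : ℕ} (h : RoutesIn G σ (t + 1)) :
    ∃ τ ρ : Equiv.Perm V, IsMatchingStep G τ ∧ RoutesIn G ρ t ∧ σ = ρ * τ := by
  obtain ⟨L, hL, hm, hf⟩ := h
  cases L with
  | nil => simp at hL
  | cons τ L =>
    have hτ : IsMatchingStep G τ := hm τ (by simp)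
    refine ⟨τ, σ * τ, hτ, ⟨L, by simpa using hL, fun x hx => hm x (by simp [hx]), ?_⟩, ?_⟩
    · intro v
      have := hf (τ v)
      simp only [finalPos, List.foldl_cons, hτ.1] at this
      simpa [finalPos] using this
    · ext v; simp [hτ.1]

lemma routes_zero_inv {σ : Equiv.Perm V} (h : RoutesIn G σ 0) : σ = 1 := by
  obtain ⟨L, hL, hm, hf⟩ := h
  have : L = [] := List.length_eq_zero_iff.1 hL
  subst this
  ext v; exact (hf v).symm

end basic

/-- Routing many copies of `H` in parallel inside `G`. -/
lemma routes_family {P R W : Type*} (H : SimpleGraph P) (G : SimpleGraph W)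
    (e : P × R ↪ W) (hadj : ∀ a b r, H.Adj a b → G.Adj (e (a, r)) (e (b, r))) (t : ℕ) :
    ∀ (π : R → Equiv.Perm P), (∀ r, RoutesIn H (π r) t) → ∀ σ : Equiv.Perm W,
      (∀ a r, σ (e (a, r)) = e (π r a, r)) → (∀ w, w ∉ Set.range e → σ w = w) →
      RoutesIn G σ t := by
  induction t with
  | zero =>
    intro π hπ σ h1 h2
    have : σ = 1 := by
      ext w
      by_cases hw : w ∈ Set.range e
      · obtain ⟨⟨a, r⟩, rfl⟩ := hw
        rw [h1, routes_zero_inv (hπ r)]; rfl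
      · exact h2 w hw
    rw [this]; exact routes_zero
  | succ t ih =>
    intro π hπ σ h1 h2
    choose τ ρ hτ hρ hπρ using fun r => routes_succ_inv (hπ r)
    let T0 : Equiv.Perm (P × R) :=
      { toFun := fun x => (τ x.2 x.1, x.2)
        invFun := fun x => (τ x.2 x.1, x.2)
        left_inv := fun x => by simp [(hτ x.2).1]
        right_inv := fun x => by simp [(hτ x.2).1] }
    let T := T0.viaEmbedding e
    have hT1 : ∀ a r, T (e (a, r)) = e (τ r a, r) := fun a r =>
      Equiv.Perm.viaEmbedding_apply T0 e (a, r)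
    have hT2 : ∀ w, w ∉ Set.range e → T w = w := fun w hw =>
      Equiv.Perm.viaEmbedding_apply_of_notMem T0 e w hw
    have hTm : IsMatchingStep G T := by
      constructor
      · intro w
        by_cases hw : w ∈ Set.range e
        · obtain ⟨⟨a, r⟩, rfl⟩ := hw
          rw [hT1, hT1, (hτ r).1]
        · rw [hT2 w hw, hT2 w hw]
      · intro w hne
        by_cases hw : w ∈ Set.range e
        · obtain ⟨⟨a, r⟩, rfl⟩ := hw
          rw [hT1] at hne ⊢
          apply hadj
          apply (hτ r).2
          intro hh
          rw [hh] at hne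
          exact hne rfl
        · exact absurd (hT2 w hw) hne
    have key : RoutesIn G (σ * T) t := by
      refine ih ρ hρ (σ * T) ?_ ?_
      · intro a r
        rw [Equiv.Perm.mul_apply, hT1, h1, hπρ r, Equiv.Perm.mul_apply, (hτ r).1]
      · intro w hw
        rw [Equiv.Perm.mul_apply, hT2 w hw, h2 w hw]
    have hσ : σ = (σ * T) * T := by
      ext w; simp [hTm.1]
    rw [hσ, add_comm t 1]
    exact routes_comp (routes_single hTm) key

/-- path on `n` vertices -/
def pathG (n : ℕ) : SimpleGraph (Fin n) where
  Adj a b := (a : ℕ) + 1 = b ∨ (b : ℕ) + 1 = a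
  symm := ⟨fun a b h => h.symm⟩
  loopless := ⟨fun a h => by omega⟩

/-- keys extended by identity -/
def key {n : ℕ} (ρ : Equiv.Perm (Fin n)) (x : ℕ) : ℕ := if h : x < n then ρ ⟨x, h⟩ else x

/-- odd-even move -/
def mv (K : ℕ → ℕ) (t x : ℕ) : ℕ :=
  if (x + t) % 2 = 0 then (if K (x + 1) < K x then x + 1 else x)
  else (if 0 < x ∧ K x < K (x - 1) then x - 1 else x)

/-- number of large keys at positions at least `y` -/
def cnt (n θ : ℕ) (K : ℕ → ℕ) (y : ℕ) : ℕ := ((Finset.Ico y n).filter fun x => θ ≤ K x).card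

lemma cnt_succ (n θ : ℕ) (K : ℕ → ℕ) (y : ℕ) (hy : y < n) :
    cnt n θ K y = (if θ ≤ K y then 1 else 0) + cnt n θ K (y + 1) := by
  unfold cnt
  rw [Finset.card_filter, Finset.card_filter, Finset.sum_eq_sum_Ico_succ_bot hy]

lemma cnt_top (n θ : ℕ) (K : ℕ → ℕ) (y : ℕ) (hy : n ≤ y) : cnt n θ K y = 0 := by
  simp [cnt, hy]

lemma mv_mv (K : ℕ → ℕ) (t x : ℕ) : mv K t (mv K t x) = x := by
  unfold mv
  by_cases h : (x + t) % 2 = 0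
  · by_cases h2 : K (x + 1) < K x
    · have : ¬ (x + 1 + t) % 2 = 0 := by omega
      simp [h, h2, this]
    · simp [h, h2]
  · by_cases h2 : 0 < x ∧ K x < K (x - 1)
    · have : (x - 1 + t) % 2 = 0 := by omega
      have e : x - 1 + 1 = x := by omega
      simp [h, h2, this, e]
    · simp [h, h2]

lemma cnt_inactive (n θ t : ℕ) (K : ℕ → ℕ) (hK : ∀ x, x + 1 = n → K x ≤ K n) (z : ℕ)
    (hz : (z + t) % 2 = 0) :
    cnt n θ (fun x => K (mv K t x)) z = cnt n θ K z := by
  by_cases h : n ≤ z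
  · rw [cnt_top _ _ _ _ h, cnt_top _ _ _ _ h]
  · by_cases h1 : z + 1 = n
    · rw [cnt_succ _ _ _ z (by omega), cnt_succ _ _ K z (by omega),
        cnt_top _ _ _ _ h1.ge, cnt_top _ _ _ _ h1.ge]
      have := hK z h1
      rw [← h1] at this
      simp [mv, hz, this.not_gt]
    · rw [cnt_succ _ _ _ z (by omega), cnt_succ _ _ _ (z + 1) (by omega),
        cnt_succ _ _ K z (by omega), cnt_succ _ _ K (z + 1) (by omega),
        cnt_inactive n θ t K hK (z + 1 + 1) (by omega)]
      have h3 : ¬ (z + 1 + t) % 2 = 0 := by omega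
      by_cases h4 : K (z + 1) < K z
      · simp only [mv, hz, h3, h4]; simp [h4]; omega
      · simp only [mv, hz, h3, h4]; simp [h4]
termination_by n - z

lemma cnt_active (n θ t : ℕ) (K : ℕ → ℕ) (hK : ∀ x, x + 1 = n → K x ≤ K n) (y : ℕ)
    (hy : (y + t) % 2 = 1) (hy0 : 0 < y) (hyn : y < n) :
    cnt n θ K (y - 1) ≤ cnt n θ (fun x => K (mv K t x)) y ∨
    cnt n θ K (y + 1) + 1 ≤ cnt n θ (fun x => K (mv K t x)) y := by
  obtain ⟨w, rfl⟩ : ∃ w, y = w + 1 := ⟨y - 1, by omega⟩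
  rw [cnt_succ _ _ (fun x => K (mv K t x)) (w + 1) hyn, cnt_inactive n θ t K hK _ (by omega)]
  simp only [Nat.add_sub_cancel]
  rw [cnt_succ _ _ K w (by omega), cnt_succ _ _ K (w + 1) (by omega)]
  have h3 : ¬ (w + 1 + t) % 2 = 0 := by omega
  simp only [mv, h3]
  by_cases h4 : K (w + 1) < K w
  · simp [h4]; split_ifs <;> omega
  · simp [h4]; split_ifs <;> omega

lemma key_lt {n : ℕ} (ρ : Equiv.Perm (Fin n)) (x : ℕ) (hx : x < n) : key ρ x < n := by
  simp [key, hx]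

lemma cnt_zero {n : ℕ} (ρ : Equiv.Perm (Fin n)) (θ : ℕ) : cnt n θ (key ρ) 0 = n - θ := by
  have : n - θ = (Finset.Ico θ n).card := by simp
  rw [this]
  unfold cnt
  refine Finset.card_bij (fun x _ => key ρ x) ?_ ?_ ?_
  · intro x hx
    simp only [Finset.mem_filter, Finset.mem_Ico] at hx ⊢
    exact ⟨hx.2, key_lt ρ x hx.1.2⟩
  · intro x hx y hy h
    simp only [Finset.mem_filter, Finset.mem_Ico] at hx hy
    simp only [key, hx.1.2, hy.1.2, dif_pos] at h
    have := ρ.injective (Fin.ext h)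
    simpa using this
  · intro b hb
    simp only [Finset.mem_Ico] at hb
    refine ⟨ρ.symm ⟨b, hb.2⟩, ?_, ?_⟩ <;> simp [key, hb.1]

lemma cnt_ge {n : ℕ} (θ : ℕ) (K : ℕ → ℕ) (y : ℕ) (hy : y ≤ n) :
    cnt n θ K 0 ≤ y + cnt n θ K y := by
  induction y with
  | zero => simp
  | succ y ih =>
    have := ih (by omega)
    rw [cnt_succ n θ K y (by omega)] at this
    split_ifs at this <;> omega

/-- routing on a path by odd-even transposition -/
lemma routes_path (n : ℕ) (σ : Equiv.Perm (Fin n)) : RoutesIn (pathG n) σ n := by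
  have main : ∀ t, ∃ ρ π : Equiv.Perm (Fin n), σ = ρ * π ∧ RoutesIn (pathG n) π t ∧
      ∀ θ ≤ n, ∀ y ≤ n, n - θ ≤ cnt n θ (key ρ) y ∨ n - y ≤ cnt n θ (key ρ) y ∨
        t + (n - θ) ≤ 2 * cnt n θ (key ρ) y + y + (y + t) % 2 := by
    intro t
    induction t with
    | zero =>
      refine ⟨σ, 1, by simp, routes_zero, ?_⟩
      intro θ hθ y hy
      have := cnt_ge (n := n) θ (key σ) y hy
      rw [cnt_zero] at this
      omega
    | succ t ih =>
      obtain ⟨ρ, π, hσ, hπ, hinv⟩ := ih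
      have hK : ∀ x, x + 1 = n → key ρ x ≤ key ρ n := by
        intro x hx
        have := key_lt ρ x (by omega)
        have e : key ρ n = n := by simp [key]
        omega
      have hlt : ∀ x, x < n → mv (key ρ) t x < n := by
        intro x hx
        unfold mv
        split_ifs with h1 h2 h3
        · by_contra hc
          have hx1 : x + 1 = n := by omega
          have := hK x hx1
          rw [hx1] at h2
          omega
        all_goals omega
      let τ : Equiv.Perm (Fin n) :=
        { toFun := fun x => ⟨mv (key ρ) t x, hlt x x.2⟩
          invFun := fun x => ⟨mv (key ρ) t x, hlt x x.2⟩
          left_inv := fun x => by simp [mv_mv]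
          right_inv := fun x => by simp [mv_mv] }
      have hτ2 : ∀ x, τ (τ x) = x := τ.left_inv
      have hτ : IsMatchingStep (pathG n) τ := by
        refine ⟨hτ2, ?_⟩
        intro x hne
        have hne' : mv (key ρ) t x ≠ x := fun h => hne (Fin.ext h)
        change (x : ℕ) + 1 = mv (key ρ) t x ∨ mv (key ρ) t x + 1 = x
        revert hne'
        unfold mv
        split_ifs <;> omega
      have hmvn : ∀ x, n ≤ x → ∀ y, y < n → cnt n y (key ρ) x = 0 := fun x hx y hy =>
        cnt_top _ _ _ _ hx
      have hcnt : ∀ θ y, cnt n θ (key (ρ * τ)) y = cnt n θ (fun x => key ρ (mv (key ρ) t x)) y := by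
        intro θ y
        unfold cnt
        congr 1
        apply Finset.filter_congr
        intro x hx
        have hx' : x < n := (Finset.mem_Ico.1 hx).2
        have : key (ρ * τ) x = key ρ (mv (key ρ) t x) := by
          have := hlt x hx'
          simp [key, hx', this]; rfl
        rw [this]
      refine ⟨ρ * τ, τ * π, ?_, routes_comp hπ (routes_single hτ), ?_⟩
      · rw [hσ]; ext x; simp [hτ2]
      · intro θ hθ y hy
        rcases Nat.eq_zero_or_pos y with rfl | hy0
        · left; rw [cnt_zero]
        rcases hy.eq_or_lt with rfl | hyn
        · right; left; omega
        rcases Nat.mod_two_eq_zero_or_one (y + t) with hp | hp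
        · have := hinv θ hθ y hy
          rw [hcnt, cnt_inactive n θ t _ hK y hp]
          omega
        · have i1 := hinv θ hθ (y - 1) (by omega)
          have i2 := hinv θ hθ (y + 1) (by omega)
          have := cnt_active n θ t _ hK y hp hy0 hyn
          rw [hcnt]
          omega
  obtain ⟨ρ, π, hσ, hπ, hinv⟩ := main n
  have hge : ∀ x : Fin n, x ≤ ρ x := by
    intro x
    have h := hinv x x.2.le x x.2.le
    have h2 : n - x ≤ cnt n x (key ρ) x := by omega
    have h3 : (Finset.Ico (x : ℕ) n).filter (fun z => (x : ℕ) ≤ key ρ z) = Finset.Ico (x : ℕ) n := by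
      apply Finset.eq_of_subset_of_card_le (Finset.filter_subset _ _)
      rw [Nat.card_Ico]; exact h2
    have h4 : (x : ℕ) ∈ Finset.Ico (x : ℕ) n := by simp
    rw [← h3] at h4
    have := (Finset.mem_filter.1 h4).2
    simpa [key] using this
  have hρ : ρ = 1 := by
    have hs : ∑ x, ((ρ x : Fin n) : ℕ) = ∑ x : Fin n, (x : ℕ) :=
      Equiv.sum_comp ρ (fun x : Fin n => (x : ℕ))
    have := (Finset.sum_eq_sum_iff_of_le (s := Finset.univ) (f := fun x : Fin n => (x : ℕ))
      (g := fun x => ((ρ x : Fin n) : ℕ)) (fun x _ => hge x)).1 hs.symm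
    ext x
    have := this x (Finset.mem_univ _)
    simp [← this]
  rw [hσ, hρ, one_mul]; exact hπ

/-- König edge colouring. -/
lemma konig {E L : Type*} [Fintype E] [DecidableEq E] [Fintype L] [DecidableEq L]
    (s t : E → L) (n : ℕ) : ∀ S : Finset E,
    (∀ l, (S.filter fun e => s e = l).card = n) → (∀ l, (S.filter fun e => t e = l).card = n) →
    ∃ c : E → ℕ, (∀ e ∈ S, c e < n) ∧
      (∀ e ∈ S, ∀ e' ∈ S, s e = s e' → c e = c e' → e = e') ∧
      (∀ e ∈ S, ∀ e' ∈ S, t e = t e' → c e = c e' → e = e') := by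
  induction n with
  | zero =>
    intro S h1 h2
    have : S = ∅ := by
      apply Finset.eq_empty_of_forall_notMem
      intro e he
      have := Finset.card_eq_zero.1 (h1 (s e))
      have h : e ∈ S.filter fun e' => s e' = s e := by simp [he]
      rw [this] at h; simp at h
    subst this
    exact ⟨fun _ => 0, by simp, by simp, by simp⟩
  | succ n ih =>
    intro S h1 h2
    have hall : ∀ A : Finset L,
        A.card ≤ (A.biUnion fun l => (S.filter fun e => s e = l).image t).card := by
      intro A
      set B := A.biUnion fun l => (S.filter fun e => s e = l).image t with hB
      have e1 : (S.filter fun e => s e ∈ A).card = ∑ l ∈ A, (n + 1) := by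
        rw [Finset.card_eq_sum_card_fiberwise (f := s) (t := A) (by intro x hx; simp at hx; exact hx.2)]
        apply Finset.sum_congr rfl
        intro l hl
        rw [← h1 l, Finset.filter_filter]
        congr 1
        apply Finset.filter_congr
        intro e he
        constructor
        · exact fun h => h.2
        · rintro rfl; exact ⟨hl, rfl⟩
      have e2 : (S.filter fun e => t e ∈ B).card = ∑ l ∈ B, (n + 1) := by
        rw [Finset.card_eq_sum_card_fiberwise (f := t) (t := B) (by intro x hx; simp only [Finset.coe_filter] at hx; exact hx.2)]
        apply Finset.sum_congr rfl
        intro l hl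
        rw [← h2 l, Finset.filter_filter]
        congr 1
        apply Finset.filter_congr
        intro e he
        constructor
        · exact fun h => h.2
        · rintro rfl; exact ⟨hl, rfl⟩
      have e3 : (S.filter fun e => s e ∈ A) ⊆ (S.filter fun e => t e ∈ B) := by
        intro e he
        simp only [Finset.mem_filter] at he ⊢
        refine ⟨he.1, ?_⟩
        rw [hB, Finset.mem_biUnion]
        exact ⟨s e, he.2, Finset.mem_image.2 ⟨e, by simp [he.1], rfl⟩⟩
      have := Finset.card_le_card e3
      rw [e1, e2] at this
      simp only [Finset.sum_const, smul_eq_mul] at this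
      exact Nat.le_of_mul_le_mul_right this (Nat.succ_pos n)
    obtain ⟨f, hfi, hf⟩ := (Finset.all_card_le_biUnion_card_iff_exists_injective _).1 hall
    have hf' : ∀ l, ∃ e, (e ∈ S ∧ s e = l) ∧ t e = f l := by
      intro l
      simpa using hf l
    choose g hg hgt using hf'
    have hfs : Function.Surjective f := Finite.surjective_of_injective hfi
    let M : Finset E := Finset.univ.image g
    have hM : ∀ e, e ∈ M ↔ ∃ l, g l = e := by simp [M]
    have hMs : ∀ e ∈ M, ∀ e' ∈ M, s e = s e' → e = e' := by
      intro e he e' he' h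
      obtain ⟨l, rfl⟩ := (hM e).1 he
      obtain ⟨l', rfl⟩ := (hM e').1 he'
      rw [(hg l).2, (hg l').2] at h; rw [h]
    have hMt : ∀ e ∈ M, ∀ e' ∈ M, t e = t e' → e = e' := by
      intro e he e' he' h
      obtain ⟨l, rfl⟩ := (hM e).1 he
      obtain ⟨l', rfl⟩ := (hM e').1 he'
      rw [hgt, hgt] at h; rw [hfi h]
    have r1 : ∀ l, ((S \ M).filter fun e => s e = l).card = n := by
      intro l
      have : (S \ M).filter (fun e => s e = l) = (S.filter fun e => s e = l).erase (g l) := by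
        ext e
        simp only [Finset.mem_filter, Finset.mem_sdiff, Finset.mem_erase]
        constructor
        · rintro ⟨⟨a, b⟩, c⟩
          exact ⟨fun h => b ((hM e).2 ⟨l, h.symm⟩), a, c⟩
        · rintro ⟨a, b, c⟩
          refine ⟨⟨b, fun h => a (hMs e h (g l) ((hM _).2 ⟨l, rfl⟩) ?_)⟩, c⟩
          rw [(hg l).2, c]
      rw [this, Finset.card_erase_of_mem (by simp [hg l]), h1]; rfl
    have r2 : ∀ l, ((S \ M).filter fun e => t e = l).card = n := by
      intro l
      obtain ⟨k, rfl⟩ := hfs l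
      have : (S \ M).filter (fun e => t e = f k) = (S.filter fun e => t e = f k).erase (g k) := by
        ext e
        simp only [Finset.mem_filter, Finset.mem_sdiff, Finset.mem_erase]
        constructor
        · rintro ⟨⟨a, b⟩, c⟩
          exact ⟨fun h => b ((hM e).2 ⟨k, h.symm⟩), a, c⟩
        · rintro ⟨a, b, c⟩
          refine ⟨⟨b, fun h => a (hMt e h (g k) ((hM _).2 ⟨k, rfl⟩) ?_)⟩, c⟩
          rw [hgt, c]
      rw [this, Finset.card_erase_of_mem (by simp [hg k, hgt k]), h2]; rfl
    obtain ⟨c, hc, hcs, hct⟩ := ih (S \ M) r1 r2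
    refine ⟨fun e => if e ∈ M then n else c e, ?_, ?_, ?_⟩
    · intro e he
      by_cases h : e ∈ M
      · simp [h]
      · have := hc e (by simp [he, h])
        simp [h]; omega
    · intro e he e' he' hs hcc
      by_cases h : e ∈ M <;> by_cases h' : e' ∈ M
      · exact hMs e h e' h' hs
      · have := hc e' (by simp [he', h']); simp [h, h'] at hcc; omega
      · have := hc e (by simp [he, h]); simp [h, h'] at hcc; omega
      · simp [h, h'] at hcc
        exact hcs e (by simp [he, h]) e' (by simp [he', h']) hs hcc
    · intro e he e' he' hs hcc
      by_cases h : e ∈ M <;> by_cases h' : e' ∈ M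
      · exact hMt e h e' h' hs
      · have := hc e' (by simp [he', h']); simp [h, h'] at hcc; omega
      · have := hc e (by simp [he, h]); simp [h, h'] at hcc; omega
      · simp [h, h'] at hcc
        exact hct e (by simp [he, h]) e' (by simp [he', h']) hs hcc


lemma inv_app {α : Type*} (f : Equiv.Perm α) (x : α) : f⁻¹ (f x) = x := f.symm_apply_apply x

/-- the `d`-dimensional mesh of side `n` -/
def meshG (d n : ℕ) : SimpleGraph (Fin d → Fin n) where
  Adj x y := ∃ j, ((x j : ℕ) + 1 = y j ∨ (y j : ℕ) + 1 = x j) ∧ ∀ i, i ≠ j → x i = y i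
  symm := ⟨fun _ _ ⟨j, h, h'⟩ => ⟨j, h.symm, fun i hi => (h' i hi).symm⟩⟩
  loopless := ⟨fun x ⟨j, h, _⟩ => by omega⟩

/-- combine a coordinate `j` with the others -/
def glue {d n : ℕ} (j : Fin d) : Fin n × ({i : Fin d // i ≠ j} → Fin n) ≃ (Fin d → Fin n) :=
  (Equiv.funSplitAt j (Fin n)).symm

lemma glue_same {d n : ℕ} (j : Fin d) (a : Fin n) (r : {i : Fin d // i ≠ j} → Fin n) :
    glue j (a, r) j = a := by
  simp [glue, Equiv.funSplitAt, Equiv.piSplitAt]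

lemma glue_ne {d n : ℕ} (j : Fin d) (a : Fin n) (r : {i : Fin d // i ≠ j} → Fin n)
    (i : Fin d) (hi : i ≠ j) : glue j (a, r) i = r ⟨i, hi⟩ := by
  simp [glue, Equiv.funSplitAt, Equiv.piSplitAt, hi]

lemma routes_line {d n : ℕ} (j : Fin d) (σ : Equiv.Perm (Fin d → Fin n))
    (h : ∀ x i, i ≠ j → σ x i = x i) : RoutesIn (meshG d n) σ n := by
  have hσ : ∀ a r, σ (glue j (a, r)) = glue j (σ (glue j (a, r)) j, r) := by
    intro a r
    ext i
    by_cases hi : i = j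
    · subst hi; rw [glue_same]
    · rw [h _ _ hi, glue_ne _ _ _ _ hi, glue_ne _ _ _ _ hi]
  have hinj : ∀ r, Function.Injective fun a => σ (glue j (a, r)) j := by
    intro r a b hab
    have hab' : σ (glue j (a, r)) j = σ (glue j (b, r)) j := hab
    have : σ (glue j (a, r)) = σ (glue j (b, r)) := by rw [hσ a, hσ b, hab']
    have := (glue j).injective (σ.injective this)
    exact (Prod.ext_iff.1 this).1
  let π : ({i : Fin d // i ≠ j} → Fin n) → Equiv.Perm (Fin n) := fun r =>
    Equiv.ofBijective _ (Finite.injective_iff_bijective.1 (hinj r))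
  refine routes_family (pathG n) (meshG d n) (glue j).toEmbedding ?_ n π
    (fun r => routes_path n _) σ hσ ?_
  · intro a b r hab
    refine ⟨j, ?_, ?_⟩
    · simp only [Equiv.coe_toEmbedding, glue_same]; exact hab
    · intro i hi
      simp only [Equiv.coe_toEmbedding, glue_ne _ _ _ _ hi]
  · intro w hw
    exact absurd ⟨(glue j).symm w, by simp⟩ hw

lemma fibre_card {d n : ℕ} (j : Fin d) (r : {i : Fin d // i ≠ j} → Fin n) :
    (Finset.univ.filter fun v : Fin d → Fin n => (fun i : {i : Fin d // i ≠ j} => v i) = r).card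
      = n := by
  have : (Finset.univ.filter fun v : Fin d → Fin n =>
      (fun i : {i : Fin d // i ≠ j} => v i) = r)
      = Finset.univ.image fun a => glue j (a, r) := by
    ext v
    simp only [Finset.mem_filter, Finset.mem_univ, true_and, Finset.mem_image]
    constructor
    · intro h
      refine ⟨v j, ?_⟩
      ext i
      by_cases hi : i = j
      · subst hi; rw [glue_same]
      · rw [glue_ne _ _ _ _ hi, ← h]
    · rintro ⟨a, rfl⟩
      funext i
      exact glue_ne _ _ _ _ i.2
  rw [this, Finset.card_image_of_injective, Finset.card_univ, Fintype.card_fin]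
  intro a b hab
  exact (Prod.ext_iff.1 ((glue j).injective hab)).1

lemma routes_mesh_aux (d n : ℕ) : ∀ j ≤ d, ∀ σ : Equiv.Perm (Fin d → Fin n),
    (∀ x (i : Fin d), j ≤ (i : ℕ) → σ x i = x i) → RoutesIn (meshG d n) σ (2 * j * n) := by
  intro j
  induction j with
  | zero =>
    intro _ σ h
    have : σ = 1 := by ext x i; rw [h x i (Nat.zero_le _)]; rfl
    rw [this]; exact routes_one _
  | succ j ih =>
    intro hj σ h
    let J : Fin d := ⟨j, hj⟩
    obtain ⟨c0, hc0, hcs, hct⟩ := konig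
      (fun (v : Fin d → Fin n) (i : {i : Fin d // i ≠ J}) => v i)
      (fun (v : Fin d → Fin n) (i : {i : Fin d // i ≠ J}) => σ v i) n Finset.univ
      (fun r => fibre_card J r) (by
        intro r
        refine Eq.trans ?_ (fibre_card (n := n) J r)
        exact Finset.card_equiv σ (by simp))
    let c : (Fin d → Fin n) → Fin n := fun v => ⟨c0 v, hc0 v (Finset.mem_univ _)⟩
    have i1 : Function.Injective fun v => Function.update v J (c v) := by
      intro v w hvw
      refine hcs v (Finset.mem_univ _) w (Finset.mem_univ _) ?_ ?_
      · funext i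
        have := congrFun hvw i
        simpa [Function.update_of_ne i.2] using this
      · have := congrFun hvw J
        simpa [c] using this
    have i2 : Function.Injective fun v => Function.update (σ v) J (c v) := by
      intro v w hvw
      refine hct v (Finset.mem_univ _) w (Finset.mem_univ _) ?_ ?_
      · funext i
        have := congrFun hvw i
        simpa [Function.update_of_ne i.2] using this
      · have := congrFun hvw J
        simpa [c] using this
    let ρ1 : Equiv.Perm (Fin d → Fin n) :=
      Equiv.ofBijective _ (Finite.injective_iff_bijective.1 i1)
    let ρ2 : Equiv.Perm (Fin d → Fin n) :=
      Equiv.ofBijective _ (Finite.injective_iff_bijective.1 i2)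
    have h1 : ∀ v, ρ1 v = Function.update v J (c v) := fun v => rfl
    have h2 : ∀ v, ρ2 v = Function.update (σ v) J (c v) := fun v => rfl
    have r1 : RoutesIn (meshG d n) ρ1 n := routes_line J ρ1 (by
      intro x i hi; rw [h1, Function.update_of_ne hi])
    have r2 : RoutesIn (meshG d n) (ρ2 * ρ1⁻¹) (2 * j * n) := by
      apply ih (by omega)
      intro x i hi
      obtain ⟨v, rfl⟩ := ρ1.surjective x
      rw [Equiv.Perm.mul_apply, inv_app, h1, h2]
      by_cases hij : i = J
      · subst hij; simp
      · rw [Function.update_of_ne hij, Function.update_of_ne hij]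
        apply h
        have : (i : ℕ) ≠ j := fun hh => hij (Fin.ext hh)
        omega
    have r3 : RoutesIn (meshG d n) (σ * ρ2⁻¹) n := routes_line J _ (by
      intro x i hi
      obtain ⟨v, rfl⟩ := ρ2.surjective x
      rw [Equiv.Perm.mul_apply, inv_app, h2, Function.update_of_ne hi])
    have := routes_comp (routes_comp r1 r2) r3
    have e1 : σ * ρ2⁻¹ * (ρ2 * ρ1⁻¹ * ρ1) = σ := by group
    rw [e1] at this
    exact routes_mono this (by ring_nf; omega)

lemma routes_mesh (d n : ℕ) (σ : Equiv.Perm (Fin d → Fin n)) :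
    RoutesIn (meshG d n) σ (2 * d * n) :=
  routes_mesh_aux d n d le_rfl σ (fun x i hi => absurd i.2 (by omega))

/-- abstract layered structure -/
lemma exists_perm_map [Fintype V] [DecidableEq V] (p : V → Prop) [DecidablePred p]
    (A B : Finset V) (hA : ∀ v ∈ A, p v) (hB : ∀ v ∈ B, p v) (hc : A.card = B.card) :
    ∃ π : Equiv.Perm V, (∀ v, ¬ p v → π v = v) ∧ (∀ v, π v ∈ B → v ∈ A) := by
  have e0 : (A.subtype p).card = (B.subtype p).card := by
    rw [Finset.card_subtype, Finset.card_subtype, Finset.filter_true_of_mem hA,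
      Finset.filter_true_of_mem hB, hc]
  let e : {x // x ∈ A.subtype p} ≃ {x // x ∈ B.subtype p} := Finset.equivOfCardEq e0
  let π0 : Equiv.Perm {x // p x} := e.extendSubtype
  refine ⟨Equiv.Perm.ofSubtype π0, ?_, ?_⟩
  · intro v hv
    exact Equiv.Perm.ofSubtype_apply_of_not_mem π0 hv
  · intro v hv
    by_cases hp : p v
    · rw [Equiv.Perm.ofSubtype_apply_of_mem π0 hp] at hv
      by_contra hA'
      have := e.extendSubtype_not_mem ⟨v, hp⟩ (by simpa using hA')
      exact this (by simpa using hv)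
    · rw [Equiv.Perm.ofSubtype_apply_of_not_mem π0 hp] at hv
      exact absurd (hB v hv) hp

section layered
variable [Fintype V] [DecidableEq V] {G : SimpleGraph V} {lev : V → ℕ} {ch : V → V} {m c : ℕ}

lemma exchange
    (hmesh : ∀ l < m, ∀ σ : Equiv.Perm V, (∀ v, lev v ≠ l → σ v = v) → RoutesIn G σ (c * 2 ^ l))
    (hadj : ∀ v, lev v + 1 < m → G.Adj v (ch v))
    (hlev : ∀ v, lev v + 1 < m → lev (ch v) = lev v + 1)
    (hinj : ∀ v w, lev v + 1 < m → lev w + 1 < m → ch v = ch w → v = w)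
    (k : ℕ) (hk : k + 1 < m) (S : Finset V)
    (hS : (S.filter fun v => lev v = k).card ≤
      (Finset.univ.filter fun v => v ∉ S ∧ lev v = k + 1).card) :
    ∃ σ : Equiv.Perm V, (∀ v, lev v ≠ k → lev v ≠ k + 1 → σ v = v) ∧
      RoutesIn G σ (c * 2 ^ (k + 1) + 1) ∧
      ∀ v ∈ S, lev v = k ∨ lev v = k + 1 → lev (σ v) = k + 1 := by
  classical
  set A := S.filter fun v => lev v = k with hAdef
  have hA : ∀ v, v ∈ A ↔ v ∈ S ∧ lev v = k := by simp [hAdef]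
  have hAk : ∀ v ∈ A, lev v = k := fun v hv => ((hA v).1 hv).2
  obtain ⟨B, hBs, hBc⟩ := Finset.exists_subset_card_eq hS
  have hB : ∀ v ∈ B, v ∉ S ∧ lev v = k + 1 := fun v hv => by simpa using hBs hv
  have chA : ∀ v ∈ A, lev (ch v) = k + 1 := fun v hv => by
    rw [hlev v (by rw [hAk v hv]; exact hk), hAk v hv]
  have chinj : ∀ v ∈ A, ∀ w ∈ A, ch v = ch w → v = w := fun v hv w hw h =>
    hinj v w (by rw [hAk v hv]; exact hk) (by rw [hAk w hw]; exact hk) h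
  obtain ⟨π, hπ1, hπ2⟩ := exists_perm_map (fun v => lev v = k + 1) B (A.image ch)
    (fun v hv => (hB v hv).2) (by
      intro v hv
      obtain ⟨a, ha, rfl⟩ := Finset.mem_image.1 hv
      exact chA a ha) (by
      rw [hBc, Finset.card_image_of_injOn]
      exact fun v hv w hw h => chinj v hv w hw h)
  let f : V → V := fun v =>
    if v ∈ A then ch v else if h : ∃ a ∈ A, ch a = v then h.choose else v
  have f1 : ∀ v ∈ A, f v = ch v := fun v hv => by simp [f, hv]
  have nA : ∀ v ∈ A, ch v ∉ A := fun v hv h => by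
    have h1 := chA v hv
    have h2 := hAk _ h
    omega
  have f2 : ∀ v ∈ A, f (ch v) = v := fun v hv => by
    have h : ∃ a ∈ A, ch a = ch v := ⟨v, hv, rfl⟩
    have h3 := h.choose_spec
    simp only [f, nA v hv, if_false, dif_pos h]
    exact chinj _ h3.1 _ hv h3.2
  have f3 : ∀ v, v ∉ A → v ∉ A.image ch → f v = v := fun v hv h => by
    have h' : ¬ ∃ a ∈ A, ch a = v := fun ⟨a, ha, e⟩ => h (Finset.mem_image.2 ⟨a, ha, e⟩)
    simp only [f, hv, if_false, dif_neg h']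
  have finv : Function.Involutive f := by
    intro v
    by_cases h1 : v ∈ A
    · rw [f1 v h1, f2 v h1]
    · by_cases h2 : v ∈ A.image ch
      · obtain ⟨a, ha, rfl⟩ := Finset.mem_image.1 h2
        rw [f2 a ha, f1 a ha]
      · rw [f3 v h1 h2, f3 v h1 h2]
  let τ : Equiv.Perm V := finv.toPerm f
  have hτ : ∀ v, τ v = f v := fun v => rfl
  have hτm : IsMatchingStep G τ := by
    refine ⟨fun v => finv v, ?_⟩
    intro v hne
    rw [hτ] at hne ⊢
    by_cases h1 : v ∈ A
    · rw [f1 v h1]; exact hadj v (by rw [hAk v h1]; exact hk)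
    · by_cases h2 : v ∈ A.image ch
      · obtain ⟨a, ha, rfl⟩ := Finset.mem_image.1 h2
        rw [f2 a ha]; exact (hadj a (by rw [hAk a ha]; exact hk)).symm
      · exact absurd (f3 v h1 h2) hne
  refine ⟨τ * π, ?_, ?_, ?_⟩
  · intro v h1 h2
    rw [Equiv.Perm.mul_apply, hπ1 v h2, hτ]
    apply f3
    · exact fun h => h1 (hAk v h)
    · intro h
      obtain ⟨a, ha, rfl⟩ := Finset.mem_image.1 h
      exact h2 (chA a ha)
  · exact routes_comp (hmesh (k + 1) hk π hπ1) (routes_single hτm)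
  · intro v hv hl
    rw [Equiv.Perm.mul_apply, hτ]
    rcases hl with hl | hl
    · rw [hπ1 v (by omega), f1 v ((hA v).2 ⟨hv, hl⟩)]
      exact chA v ((hA v).2 ⟨hv, hl⟩)
    · have hπl : lev (π v) = k + 1 := by
        by_contra hc
        have := hπ1 _ hc
        have := π.injective this
        rw [this] at hc
        exact hc hl
      rw [f3, hπl]
      · intro h
        have := hAk _ h
        omega
      · intro h
        exact (hB v (hπ2 v h)).1 hv

lemma gather
    (hmesh : ∀ l < m, ∀ σ : Equiv.Perm V, (∀ v, lev v ≠ l → σ v = v) → RoutesIn G σ (c * 2 ^ l))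
    (hadj : ∀ v, lev v + 1 < m → G.Adj v (ch v))
    (hlev : ∀ v, lev v + 1 < m → lev (ch v) = lev v + 1)
    (hinj : ∀ v w, lev v + 1 < m → lev w + 1 < m → ch v = ch w → v = w)
    (hcard : ∀ k < m, (Finset.univ.filter fun v => lev v < k).card ≤
      (Finset.univ.filter fun v => lev v = k).card) (hc : 1 ≤ c) :
    ∀ k < m, ∀ S : Finset V, (∀ v ∈ S, lev v ≤ k) →
      S.card ≤ (Finset.univ.filter fun v => lev v = k).card →
      ∃ σ : Equiv.Perm V, (∀ v, k < lev v → σ v = v) ∧ RoutesIn G σ (6 * c * 2 ^ k) ∧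
        ∀ v ∈ S, lev (σ v) = k := by
  intro k
  induction k with
  | zero =>
    intro _ S hS _
    exact ⟨1, fun _ _ => rfl, routes_one _, fun v hv => by simpa using hS v hv⟩
  | succ k ih =>
    intro hk S hS hSc
    -- the counting condition for the exchange step
    have cond : ∀ S : Finset V, S.card ≤ (Finset.univ.filter fun v => lev v = k + 1).card →
        (S.filter fun v => lev v = k).card ≤
        (Finset.univ.filter fun v => v ∉ S ∧ lev v = k + 1).card := by
      intro S hS
      have e1 : (S.filter fun v => lev v = k).card + (S.filter fun v => lev v = k + 1).card
          ≤ S.card := by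
        rw [← Finset.card_union_of_disjoint]
        · apply Finset.card_le_card
          intro v hv
          simp only [Finset.mem_union, Finset.mem_filter] at hv
          tauto
        · rw [Finset.disjoint_left]
          intro v h1 h2
          simp only [Finset.mem_filter] at h1 h2
          omega
      have e2 : (Finset.univ.filter fun v => lev v = k + 1).card ≤
          (S.filter fun v => lev v = k + 1).card +
          (Finset.univ.filter fun v => v ∉ S ∧ lev v = k + 1).card := by
        refine le_trans (Finset.card_le_card ?_) (Finset.card_union_le _ _)
        intro v hv
        simp only [Finset.mem_union, Finset.mem_filter, Finset.mem_univ, true_and] at hv ⊢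
        tauto
      omega
    obtain ⟨σ1, s1, r1, g1⟩ := exchange hmesh hadj hlev hinj k hk S (cond S hSc)
    have lev1 : ∀ v ∈ S, lev (σ1 v) < k ∨ lev (σ1 v) = k + 1 := by
      intro v hv
      by_cases h : lev v = k ∨ lev v = k + 1
      · exact Or.inr (g1 v hv h)
      · have := hS v hv
        rw [s1 v (by tauto) (by tauto)]
        omega
    let S1 := (S.image σ1).filter fun v => lev v < k
    obtain ⟨σ2, s2, r2, g2⟩ := ih (by omega) S1 (by
      intro v hv
      exact (Finset.mem_filter.1 hv).2.le) (by
      refine le_trans (Finset.card_le_card ?_) (hcard k (by omega))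
      intro v hv
      simpa using (Finset.mem_filter.1 hv).2)
    have lev2 : ∀ v ∈ S, lev (σ2 (σ1 v)) = k ∨ lev (σ2 (σ1 v)) = k + 1 := by
      intro v hv
      rcases lev1 v hv with h | h
      · left
        exact g2 _ (Finset.mem_filter.2 ⟨Finset.mem_image_of_mem _ hv, h⟩)
      · right
        rw [s2 _ (by omega), h]
    obtain ⟨σ3, s3, r3, g3⟩ := exchange hmesh hadj hlev hinj k hk (S.image (σ2 * σ1)) (cond _ (by
      rw [Finset.card_image_of_injective _ (σ2 * σ1).injective]; exact hSc))
    refine ⟨σ3 * (σ2 * σ1), ?_, ?_, ?_⟩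
    · intro v hv
      rw [Equiv.Perm.mul_apply, Equiv.Perm.mul_apply, s1 v (by omega) (by omega),
        s2 v (by omega), s3 v (by omega) (by omega)]
    · refine routes_mono (routes_comp (routes_comp r1 r2) r3) ?_
      have : 1 ≤ c * 2 ^ k := Nat.mul_pos hc (by positivity)
      have e : c * 2 ^ (k + 1) = 2 * (c * 2 ^ k) := by ring
      have e' : 6 * c * 2 ^ (k + 1) = 12 * (c * 2 ^ k) := by ring
      have e6 : 6 * c * 2 ^ k = 6 * (c * 2 ^ k) := by ring
      rw [e, e', e6]; omega
    · intro v hv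
      exact g3 _ (Finset.mem_image_of_mem _ hv) (lev2 v hv)

lemma routes_layered
    (hmesh : ∀ l < m, ∀ σ : Equiv.Perm V, (∀ v, lev v ≠ l → σ v = v) → RoutesIn G σ (c * 2 ^ l))
    (hadj : ∀ v, lev v + 1 < m → G.Adj v (ch v))
    (hlev : ∀ v, lev v + 1 < m → lev (ch v) = lev v + 1)
    (hinj : ∀ v w, lev v + 1 < m → lev w + 1 < m → ch v = ch w → v = w)
    (hcard : ∀ k < m, (Finset.univ.filter fun v => lev v < k).card ≤
      (Finset.univ.filter fun v => lev v = k).card) (hc : 1 ≤ c) :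
    ∀ k ≤ m, ∀ σ : Equiv.Perm V, (∀ v, k ≤ lev v → σ v = v) →
      RoutesIn G σ (7 * c * 2 ^ k) := by
  intro k
  induction k with
  | zero =>
    intro _ σ h
    have : σ = 1 := by ext v; rw [h v (Nat.zero_le _)]; rfl
    rw [this]; exact routes_one _
  | succ k ih =>
    intro hk σ h
    have hσle : ∀ v, lev (σ v) ≤ k → lev v ≤ k := by
      intro v hv
      by_contra hc
      rw [h v (by omega)] at hv
      omega
    let S : Finset V := Finset.univ.filter fun v => lev (σ v) = k
    have hScard : S.card = (Finset.univ.filter fun v => lev v = k).card :=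
      Finset.card_equiv σ (by simp [S])
    obtain ⟨τ, t1, t2, t3⟩ := gather hmesh hadj hlev hinj hcard hc k hk S (by
      intro v hv
      apply hσle
      have : lev (σ v) = k := by simpa [S] using hv
      omega) hScard.le
    have himg : S.image τ = Finset.univ.filter fun v => lev v = k := by
      apply Finset.eq_of_subset_of_card_le
      · intro v hv
        obtain ⟨a, ha, rfl⟩ := Finset.mem_image.1 hv
        simpa using t3 a ha
      · rw [Finset.card_image_of_injective _ τ.injective, hScard]
    let ρ := σ * τ⁻¹
    have hρ : ∀ v, lev (ρ v) = k ↔ lev v = k := by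
      intro v
      obtain ⟨u, rfl⟩ := τ.surjective v
      have e : ρ (τ u) = σ u := by simp [ρ]
      rw [e]
      constructor
      · intro hu
        exact t3 u (by simpa [S] using hu)
      · intro hu
        have : τ u ∈ S.image τ := by rw [himg]; simpa using hu
        obtain ⟨a, ha, e⟩ := Finset.mem_image.1 this
        rw [τ.injective e] at ha
        simpa [S] using ha
    have hρfix : ∀ v, k + 1 ≤ lev v → ρ v = v := by
      intro v hv
      have : τ⁻¹ v = v := by
        rw [Equiv.Perm.inv_eq_iff_eq]; exact (t1 v hv).symm
      rw [Equiv.Perm.mul_apply, this, h v hv]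
    let ρ1 : Equiv.Perm V := Equiv.Perm.ofSubtype (ρ.subtypePerm (p := fun v => lev v = k) hρ)
    have hρ1a : ∀ v, lev v = k → ρ1 v = ρ v := by
      intro v hv
      simp only [ρ1]
      exact (Equiv.Perm.ofSubtype_apply_of_mem (p := fun v => lev v = k) _ hv).trans rfl
    have hρ1b : ∀ v, lev v ≠ k → ρ1 v = v := by
      intro v hv
      exact Equiv.Perm.ofSubtype_apply_of_not_mem _ hv
    have q1 : RoutesIn G ρ1 (c * 2 ^ k) := hmesh k hk ρ1 hρ1b
    have q2 : RoutesIn G (ρ * ρ1⁻¹) (7 * c * 2 ^ k) := by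
      apply ih (by omega)
      intro v hv
      obtain ⟨u, rfl⟩ := ρ1.surjective v
      rw [Equiv.Perm.mul_apply, inv_app]
      by_cases hu : lev u = k
      · rw [hρ1a u hu]
      · rw [hρ1b u hu] at hv ⊢
        exact hρfix u (by omega)
    have := routes_comp (routes_comp t2 q1) q2
    have e : ρ * ρ1⁻¹ * (ρ1 * τ) = σ := by simp only [ρ]; group
    rw [e] at this
    refine routes_mono this (le_of_eq (by ring))

end layered


section pyr
variable {m d : ℕ}

/-- level of a vertex -/
def plev (v : PyrV m d) : ℕ := v.1.1

/-- embedding of the level `l` mesh -/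
def emb (d : ℕ) {m l : ℕ} (hl : l < m) (x : Fin d → Fin (2 ^ l)) : PyrV m d :=
  ⟨(⟨l, hl⟩, fun i => ⟨x i, (x i).2.trans_le (Nat.pow_le_pow_right (by norm_num) hl.le)⟩),
    fun i => (x i).2⟩

lemma plev_emb {l : ℕ} (hl : l < m) (x : Fin d → Fin (2 ^ l)) : plev (emb d hl x) = l := rfl

lemma emb_inj {l : ℕ} (hl : l < m) : Function.Injective (emb d hl) := by
  intro x y h
  funext i
  have h1 := congrArg (fun v : PyrV m d => ((v.1.2 i : Fin (2 ^ m)) : ℕ)) h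
  exact Fin.ext h1

lemma emb_surj {l : ℕ} (hl : l < m) (v : PyrV m d) (hv : plev v = l) : ∃ x, emb d hl x = v := by
  subst hv
  refine ⟨fun i => ⟨v.1.2 i, v.2 i⟩, ?_⟩
  rfl

lemma emb_adj {l : ℕ} (hl : l < m) (x y : Fin d → Fin (2 ^ l)) (h : (meshG d (2 ^ l)).Adj x y) :
    (pyramid m d).Adj (emb d hl x) (emb d hl y) := by
  rw [pyramid, SimpleGraph.fromRel_adj]
  refine ⟨fun e => h.ne (emb_inj hl e), ?_⟩
  obtain ⟨j, h1, h2⟩ := h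
  rcases h1 with h1 | h1
  · left; left
    refine ⟨rfl, j, h1, fun i hi => ?_⟩
    apply Fin.ext
    change (x i : ℕ) = y i
    rw [h2 i hi]
  · right; left
    refine ⟨rfl, j, h1, fun i hi => ?_⟩
    apply Fin.ext
    change (y i : ℕ) = x i
    rw [h2 i hi]

lemma pyr_mesh : ∀ l < m, ∀ σ : Equiv.Perm (PyrV m d), (∀ v, plev v ≠ l → σ v = v) →
    RoutesIn (pyramid m d) σ (2 * d * 2 ^ l) := by
  intro l hl σ h
  have hs : ∀ x, ∃ y, emb d hl y = σ (emb d hl x) := by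
    intro x
    apply emb_surj
    by_contra hc
    have := σ.injective (h _ hc)
    rw [this] at hc
    exact hc rfl
  choose f hf using hs
  have fi : Function.Injective f := by
    intro x y hxy
    apply emb_inj hl
    apply σ.injective
    rw [← hf, ← hf, hxy]
  let π : Equiv.Perm (Fin d → Fin (2 ^ l)) :=
    Equiv.ofBijective f (Finite.injective_iff_bijective.1 fi)
  let e : (Fin d → Fin (2 ^ l)) × Unit ↪ PyrV m d :=
    ⟨fun x => emb d hl x.1, fun x y hxy => Prod.ext (emb_inj hl hxy) rfl⟩
  refine routes_family (meshG d (2 ^ l)) (pyramid m d) e (fun a b _ hab => emb_adj hl a b hab) _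
    (fun _ => π) (fun _ => routes_mesh _ _ _) σ (fun a _ => (hf a).symm) ?_
  intro w hw
  apply h
  intro hw'
  obtain ⟨x, hx⟩ := emb_surj hl w hw'
  exact hw ⟨(x, ()), hx⟩

/-- the corner child -/
def chd (v : PyrV m d) : PyrV m d :=
  if h : plev v + 1 < m then
    ⟨(⟨plev v + 1, h⟩, fun i => ⟨2 * (v.1.2 i : ℕ), by
        have h1 := v.2 i
        have h2 : 2 ^ (plev v + 1) ≤ 2 ^ m := Nat.pow_le_pow_right (by norm_num) h.le
        rw [pow_succ] at h2
        unfold plev at h2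
        omega⟩), by
        intro i
        have h1 := v.2 i
        change 2 * (v.1.2 i : ℕ) < 2 ^ (plev v + 1)
        rw [pow_succ]
        unfold plev
        omega⟩
  else v

lemma chd_lev (v : PyrV m d) (h : plev v + 1 < m) : plev (chd v) = plev v + 1 := by
  unfold chd; rw [dif_pos h]; rfl

lemma chd_coord (v : PyrV m d) (h : plev v + 1 < m) (i : Fin d) :
    ((chd v).1.2 i : ℕ) = 2 * (v.1.2 i : ℕ) := by
  unfold chd; rw [dif_pos h]

lemma chd_adj (v : PyrV m d) (h : plev v + 1 < m) : (pyramid m d).Adj v (chd v) := by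
  rw [pyramid, SimpleGraph.fromRel_adj]
  have h1 := chd_lev v h
  refine ⟨fun e => ?_, ?_⟩
  · rw [← e] at h1; omega
  · left; right
    refine ⟨h1.symm, fun i => ?_⟩
    rw [chd_coord v h i]; omega

lemma chd_inj (v w : PyrV m d) (hv : plev v + 1 < m) (hw : plev w + 1 < m)
    (h : chd v = chd w) : v = w := by
  have h1 := chd_lev v hv
  have h2 := chd_lev w hw
  rw [h] at h1
  apply Subtype.ext
  apply Prod.ext
  · apply Fin.ext
    change plev v = plev w
    omega
  · funext i
    apply Fin.ext
    have h3 := chd_coord v hv i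
    have h4 := chd_coord w hw i
    rw [h] at h3
    omega

lemma level_card (k : ℕ) (hk : k < m) :
    (Finset.univ.filter fun v : PyrV m d => plev v = k).card = (2 ^ k) ^ d := by
  have : (Finset.univ.filter fun v : PyrV m d => plev v = k) = Finset.univ.image (emb d hk) := by
    ext v
    simp only [Finset.mem_filter, Finset.mem_univ, true_and, Finset.mem_image]
    constructor
    · intro h; exact emb_surj hk v h
    · rintro ⟨x, rfl⟩; rfl
  rw [this, Finset.card_image_of_injective _ (emb_inj hk)]
  simp

lemma below_card (hd : 1 ≤ d) : ∀ k < m,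
    (Finset.univ.filter fun v : PyrV m d => plev v < k).card ≤
      (Finset.univ.filter fun v : PyrV m d => plev v = k).card := by
  intro k
  induction k with
  | zero => intro _; simp
  | succ k ih =>
    intro hk
    have h1 := ih (by omega)
    rw [level_card k (by omega)] at h1
    rw [level_card (k + 1) hk]
    have h2 : (Finset.univ.filter fun v : PyrV m d => plev v < k + 1).card ≤
        (Finset.univ.filter fun v : PyrV m d => plev v < k).card +
        (Finset.univ.filter fun v : PyrV m d => plev v = k).card := by
      refine le_trans (Finset.card_le_card ?_) (Finset.card_union_le _ _)
      intro v hv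
      simp only [Finset.mem_union, Finset.mem_filter, Finset.mem_univ, true_and] at hv ⊢
      omega
    rw [level_card k (by omega)] at h2
    have h3 : (2 ^ (k + 1)) ^ d = (2 ^ k) ^ d * 2 ^ d := by rw [pow_succ, mul_pow]
    have h4 : 2 ^ 1 ≤ 2 ^ d := Nat.pow_le_pow_right (by norm_num) hd
    have h5 : (2 ^ k) ^ d * 2 ^ 1 ≤ (2 ^ k) ^ d * 2 ^ d := Nat.mul_le_mul_left _ h4
    omega

lemma rt_le (hd : 1 ≤ d) : rt (pyramid m d) ≤ 7 * (2 * d) * 2 ^ m := by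
  unfold rt
  apply Finset.sup_le
  intro σ _
  apply Nat.sInf_le
  exact routes_layered (lev := plev) (ch := chd) pyr_mesh chd_adj chd_lev chd_inj
    (below_card hd) (by omega) m le_rfl σ
    (fun v hv => absurd v.1.1.2 (by unfold plev at hv; omega))

end pyr

end PyrRoute

/-- the routing number of the `d`-dimensional pyramid `Δ_{m,d}`
with `N` vertices is `O(d · N^{1/d})`. -/
theorem stmt19 :
    ∃ C : ℝ, 0 < C ∧ ∀ m d : ℕ, 1 ≤ m → 1 ≤ d →
      (rt (pyramid m d) : ℝ) ≤
        C * d * (Fintype.card (PyrV m d) : ℝ) ^ (1 / (d : ℝ)) := by 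
  refine ⟨28, by norm_num, ?_⟩
  intro m d hm hd
  have h1 : (rt (pyramid m d) : ℝ) ≤ 7 * (2 * d) * 2 ^ m := by
    exact_mod_cast PyrRoute.rt_le (m := m) hd
  have h2 : (2 ^ (m - 1)) ^ d ≤ Fintype.card (PyrV m d) := by
    rw [← PyrRoute.level_card (m := m) (d := d) (m - 1) (by omega)]
    exact Finset.card_le_univ _
  have h2' : (((2 : ℝ) ^ (m - 1)) ^ d) ≤ (Fintype.card (PyrV m d) : ℝ) := by exact_mod_cast h2
  have h3 : (2 : ℝ) ^ (m - 1) ≤ (Fintype.card (PyrV m d) : ℝ) ^ (1 / (d : ℝ)) := by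
    calc (2 : ℝ) ^ (m - 1) = (((2 : ℝ) ^ (m - 1)) ^ d) ^ (1 / (d : ℝ)) := by
          rw [one_div, Real.pow_rpow_inv_natCast (by positivity) (by omega)]
      _ ≤ _ := Real.rpow_le_rpow (by positivity) h2' (by positivity)
  have h4 : (2 : ℝ) ^ m = 2 * 2 ^ (m - 1) := by
    rw [← pow_succ']; congr 1; omega
  calc (rt (pyramid m d) : ℝ) ≤ 7 * (2 * d) * 2 ^ m := h1
    _ = 28 * d * 2 ^ (m - 1) := by rw [h4]; ring
    _ ≤ _ := by gcongr
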